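/- arXiv:2404.02839 — 3 statements merged into one kernel-verified Lean document; each statement's English description precedes it below -/
import Mathlib

section
/- Let R be a commutative ring in which 2 = 0, and let A = R[x]/(x²). Every R-algebra automorphism φ of A satisfies φ(x̄) = a + b·x̄ with a ∈ R, a² = 0, and b a unit of R, and the resulting map Ψ : Aut_{R-alg}(A) → {a ∈ R : a² = 0} × Rˣ, Ψ(φ) = (a, b), is a bijection. Moreover Ψ(φ₁ ∘ φ₂) = (a₁ + b₁·a₂, b₁·b₂) whenever Ψ(φᵢ) = (aᵢ, bᵢ); hence Aut_{R-alg}(A) is isomorphic as a group to the semidirect product of the additive group {a ∈ R : a² = 0} by the unit group Rˣ acting by multiplication. (This exhibits the automorphism group scheme of Spec k[x]/(x²) in characteristic 2 as α₂ ⋊ 𝔾ₘ, which is not smooth.) -/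
namespace TruncatedPolynomial

open Polynomial

/-- The algebra `R[x]/(x²)`. -/
abbrev TruncPoly (R : Type*) [CommRing R] := R[X] ⧸ Ideal.span {(X : R[X]) ^ 2}

variable {R : Type*} [CommRing R]

/-- The class `x̄` of the variable in `R[x]/(x²)`. -/
noncomputable abbrev root (R : Type*) [CommRing R] : TruncPoly R :=
  Ideal.Quotient.mk (Ideal.span {(X : R[X]) ^ 2}) X

/-- The element `a + b·x̄` of `R[x]/(x²)`. -/
noncomputable abbrev lin (a b : R) : TruncPoly R := algebraMap R _ a + algebraMap R _ b * root R

theorem root_sq : root R ^ 2 = 0 := by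
  rw [← map_pow, Ideal.Quotient.eq_zero_iff_mem]
  exact Ideal.mem_span_singleton_self _

theorem lin_eq_mk (a b : R) :
    lin a b = Ideal.Quotient.mk (Ideal.span {(X : R[X]) ^ 2}) (C a + C b * X) := by
  rw [map_add, map_mul]
  rfl

theorem lin_injective {a b c d : R} (h : lin a b = lin c d) : a = c ∧ b = d := by
  rw [lin_eq_mk, lin_eq_mk, Ideal.Quotient.mk_eq_mk_iff_sub_mem, Ideal.mem_span_singleton,
    X_pow_dvd_iff] at h
  have h0 := h 0 (by norm_num)
  have h1 := h 1 (by norm_num)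
  simp [coeff_C] at h0 h1
  exact ⟨sub_eq_zero.mp h0, sub_eq_zero.mp h1⟩

theorem exists_eq_lin (y : TruncPoly R) : ∃ a b : R, y = lin a b := by
  obtain ⟨p, rfl⟩ := Ideal.Quotient.mk_surjective y
  refine ⟨p.coeff 0, p.coeff 1, ?_⟩
  rw [lin_eq_mk, Ideal.Quotient.mk_eq_mk_iff_sub_mem, Ideal.mem_span_singleton, X_pow_dvd_iff]
  intro d hd
  interval_cases d <;> simp [coeff_C]

theorem map_lin (φ : TruncPoly R →ₐ[R] TruncPoly R) (a b : R) :
    φ (lin a b) = algebraMap R _ a + algebraMap R _ b * φ (root R) := by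
  simp only [lin, map_add, map_mul, AlgHom.commutes]

theorem map_lin_of_map_root {φ : TruncPoly R →ₐ[R] TruncPoly R} {c d : R} (h : φ (root R) = lin c d)
    (a b : R) : φ (lin a b) = lin (a + b * c) (b * d) := by
  rw [map_lin, h]
  simp only [lin, map_add, map_mul]
  ring

theorem root_eq_lin : root R = lin 0 1 := by
  simp [lin]

theorem algHom_ext {φ ψ : TruncPoly R →ₐ[R] TruncPoly R} (h : φ (root R) = ψ (root R)) : φ = ψ := by
  ext y
  obtain ⟨a, b, rfl⟩ := exists_eq_lin y
  rw [map_lin, map_lin, h]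

theorem lin_sq (h2 : (2 : R) = 0) (a b : R) : lin a b ^ 2 = algebraMap R _ (a ^ 2) := by
  have h : (2 : TruncPoly R) = 0 := by
    rw [← map_ofNat (algebraMap R (TruncPoly R)) 2, h2, map_zero]
  simp only [lin, map_pow]
  linear_combination algebraMap R (TruncPoly R) b ^ 2 * root_sq (R := R) +
    algebraMap R (TruncPoly R) a * algebraMap R (TruncPoly R) b * root R * h

theorem lin_sq_eq_zero_iff (h2 : (2 : R) = 0) (a b : R) : lin a b ^ 2 = 0 ↔ a ^ 2 = 0 := by
  rw [lin_sq h2]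
  refine ⟨fun h => ?_, fun h => by rw [h, map_zero]⟩
  exact (lin_injective (a := a ^ 2) (b := 0) (c := 0) (d := 0) (by simp [lin, h])).1

theorem exists_algHom {y : TruncPoly R} (hy : y ^ 2 = 0) :
    ∃ φ : TruncPoly R →ₐ[R] TruncPoly R, φ (root R) = y := by
  refine ⟨Ideal.Quotient.liftₐ _ (aeval y) fun p hp => ?_, ?_⟩
  · obtain ⟨q, rfl⟩ := Ideal.mem_span_singleton.mp hp
    simp [hy]
  · exact aeval_X y

theorem exists_algEquiv (h2 : (2 : R) = 0) {a : R} (ha : a ^ 2 = 0) (b : Rˣ) :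
    ∃ φ : TruncPoly R ≃ₐ[R] TruncPoly R, φ (root R) = lin a b := by
  obtain ⟨φ, hφ⟩ := exists_algHom ((lin_sq_eq_zero_iff h2 a b).mpr ha)
  obtain ⟨ψ, hψ⟩ := exists_algHom
    ((lin_sq_eq_zero_iff h2 (-(↑b⁻¹ * a)) ↑b⁻¹).mpr (by rw [neg_sq, mul_pow, ha, mul_zero]))
  refine ⟨AlgEquiv.ofAlgHom φ ψ (algHom_ext ?_) (algHom_ext ?_), hφ⟩
  · rw [AlgHom.comp_apply, hψ, map_lin_of_map_root hφ, AlgHom.id_apply, root_eq_lin]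
    simp
  · rw [AlgHom.comp_apply, hφ, map_lin_of_map_root hψ, AlgHom.id_apply, root_eq_lin]
    simp

theorem exists_map_root_eq (h2 : (2 : R) = 0) (φ : TruncPoly R ≃ₐ[R] TruncPoly R) :
    ∃ p : {a : R // a ^ 2 = 0} × Rˣ, φ (root R) = lin (p.1 : R) (p.2 : R) := by
  obtain ⟨a, b, h⟩ := exists_eq_lin (φ (root R))
  obtain ⟨c, d, h'⟩ := exists_eq_lin (φ.symm (root R))
  have ha : a ^ 2 = 0 := by
    rw [← lin_sq_eq_zero_iff h2 a b, ← h, ← map_pow, root_sq, map_zero]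
  have hdb : lin (c + d * a) (d * b) = lin 0 1 := by
    rw [← map_lin_of_map_root (φ := φ.toAlgHom) h, ← h', ← root_eq_lin]
    exact φ.apply_symm_apply _
  have hb : d * b = 1 := (lin_injective hdb).2
  exact ⟨(⟨a, ha⟩, ⟨b, d, by rw [mul_comm, hb], hb⟩), h⟩

end TruncatedPolynomial

open TruncatedPolynomial in
/-- Let `R` be a commutative ring with `2 = 0` and let `A = R[x]/(x²)`.  Every `R`-algebra
automorphism `φ` of `A` satisfies `φ(x̄) = a + b·x̄` with `a² = 0` and `b` a unit, and the map
`Ψ : Aut(A) → {a : a² = 0} × Rˣ` so obtained is a bijection satisfying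
`Ψ(φ₁ ∘ φ₂) = (a₁ + b₁ a₂, b₁ b₂)`; hence `Aut(A)` is the semidirect product of the additive
group `{a : a² = 0}` by `Rˣ`.  (For `R = k` a field of characteristic `2` this exhibits
`Aut(Spec k[x]/(x²)) ≅ α₂ ⋊ 𝔾ₘ`, which is not smooth.) -/
theorem stmt5 (R : Type*) [CommRing R] (h2 : (2 : R) = 0) :
    ∃ Ψ : ((Polynomial R ⧸ Ideal.span {(Polynomial.X : Polynomial R) ^ 2}) ≃ₐ[R]
           (Polynomial R ⧸ Ideal.span {(Polynomial.X : Polynomial R) ^ 2})) →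
          {a : R // a ^ 2 = 0} × Rˣ,
      Function.Bijective Ψ ∧
      (∀ φ, φ (Ideal.Quotient.mk (Ideal.span {(Polynomial.X : Polynomial R) ^ 2}) Polynomial.X)
          = algebraMap R _ ((Ψ φ).1 : R)
            + algebraMap R _ (((Ψ φ).2 : Rˣ) : R)
              * Ideal.Quotient.mk (Ideal.span {(Polynomial.X : Polynomial R) ^ 2})
                  Polynomial.X) ∧
      (∀ φ₁ φ₂,
        ((Ψ (φ₁.trans φ₂)).1 : R)
            = ((Ψ φ₁).1 : R) + (((Ψ φ₁).2 : Rˣ) : R) * ((Ψ φ₂).1 : R) ∧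
        (Ψ (φ₁.trans φ₂)).2 = (Ψ φ₁).2 * (Ψ φ₂).2) := by
  choose Ψ hΨ using exists_map_root_eq h2
  refine ⟨Ψ, ⟨fun φ ψ h => ?_, fun ⟨⟨a, ha⟩, b⟩ => ?_⟩, hΨ, fun φ₁ φ₂ => ?_⟩
  · apply AlgEquiv.coe_toAlgHom_injective
    apply algHom_ext
    exact (hΨ φ).trans (h ▸ (hΨ ψ).symm)
  · obtain ⟨φ, hφ⟩ := exists_algEquiv h2 ha b
    obtain ⟨h₁, h₂⟩ := lin_injective ((hΨ φ).symm.trans hφ)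
    exact ⟨φ, Prod.ext (Subtype.ext h₁) (Units.ext h₂)⟩
  · have h : φ₂ (φ₁ (root R)) = lin ((Ψ φ₁).1 + (Ψ φ₁).2 * (Ψ φ₂).1 : R)
        ((Ψ φ₁).2 * (Ψ φ₂).2 : R) := by
      rw [hΨ φ₁]
      exact map_lin_of_map_root (φ := φ₂.toAlgHom) (hΨ φ₂) _ _
    obtain ⟨h₁, h₂⟩ := lin_injective ((hΨ (φ₁.trans φ₂)).symm.trans h)
    exact ⟨h₁, Units.ext h₂⟩
end

section
/- Let k be a field of characteristic 2 and let a ∈ k with a ∉ k². Let A = k[x,y]/(x⁴, y² − a·x²) and B = k[s,t]/(s⁴, t²). Then A and B are both 8-dimensional commutative local k-algebras, the k-subspace {f ∈ A : f² = 0} has dimension 5 over k, the k-subspace {f ∈ B : f² = 0} has dimension 6 over k, and consequently there is no k-algebra isomorphism between A and B. (Hence the structure theorem for connected finite group schemes over a perfect field fails over non-perfect fields.) -/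
open MvPolynomial

namespace SquareZero

variable {k : Type*} [Field k]

/-- The `k`-algebra `k[x, y] / (x⁴, y² - a x²)`. -/
abbrev Quot4 (k : Type*) [Field k] (a : k) : Type _ :=
  MvPolynomial (Fin 2) k ⧸
    Ideal.span {(X 0 : MvPolynomial (Fin 2) k) ^ 4, X 1 ^ 2 - C a * X 0 ^ 2}

/-- The class of `x`. -/
noncomputable def x (a : k) : Quot4 k a := Ideal.Quotient.mk _ (X 0)

/-- The class of `y`. -/
noncomputable def y (a : k) : Quot4 k a := Ideal.Quotient.mk _ (X 1)

lemma x_pow_four (a : k) : x a ^ 4 = 0 := by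
  rw [x, ← map_pow, Ideal.Quotient.eq_zero_iff_mem]
  exact Ideal.subset_span (by simp)

lemma y_sq (a : k) : y a ^ 2 = algebraMap k _ a * x a ^ 2 := by
  have h : Ideal.Quotient.mk (Ideal.span {(X 0 : MvPolynomial (Fin 2) k) ^ 4,
      X 1 ^ 2 - C a * X 0 ^ 2}) (X 1 ^ 2 - C a * X 0 ^ 2) = 0 :=
    Ideal.Quotient.eq_zero_iff_mem.2 (Ideal.subset_span (by simp))
  rw [map_sub, sub_eq_zero, map_pow, map_mul, map_pow] at h
  exact h

/-- The monomials `xⁱ yʲ` with `i < 4` and `j < 2`. -/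
noncomputable def monomials (a : k) : Fin 8 → Quot4 k a :=
  ![1, x a, x a ^ 2, x a ^ 3, y a, x a * y a, x a ^ 2 * y a, x a ^ 3 * y a]

/-- The linear map sending a coefficient vector to the combination of the monomials. -/
noncomputable def combination (a : k) : (Fin 8 → k) →ₗ[k] Quot4 k a :=
  Fintype.linearCombination k (monomials a)

lemma combination_apply (a : k) (c : Fin 8 → k) :
    combination a c = algebraMap k _ (c 0) + algebraMap k _ (c 1) * x a
      + algebraMap k _ (c 2) * x a ^ 2 + algebraMap k _ (c 3) * x a ^ 3
      + algebraMap k _ (c 4) * y a + algebraMap k _ (c 5) * (x a * y a)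
      + algebraMap k _ (c 6) * (x a ^ 2 * y a) + algebraMap k _ (c 7) * (x a ^ 3 * y a) := by
  have hsmul (r : k) (f : Quot4 k a) : r • f = algebraMap k _ r * f := Algebra.smul_def r f
  simp only [combination, Fintype.linearCombination_apply, Fin.sum_univ_eight, hsmul]
  simp [monomials]

lemma combination_surjective (a : k) : Function.Surjective (combination a) := by
  have hx := x_pow_four a
  have hy := y_sq a
  intro f
  obtain ⟨p, rfl⟩ := Ideal.Quotient.mk_surjective f
  induction p using MvPolynomial.induction_on with
  | C r =>
    refine ⟨![r, 0, 0, 0, 0, 0, 0, 0], ?_⟩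
    rw [combination_apply]
    simp
    rfl
  | add p q hp hq =>
    obtain ⟨c, hc⟩ := hp
    obtain ⟨d, hd⟩ := hq
    exact ⟨c + d, by rw [map_add, map_add, hc, hd]⟩
  | mul_X p i hp =>
    obtain ⟨c, hc⟩ := hp
    rw [map_mul, ← hc]
    fin_cases i
    · refine ⟨![0, c 0, c 1, c 2, 0, c 4, c 5, c 6], ?_⟩
      change _ = _ * x a
      rw [combination_apply, combination_apply]
      simp
      linear_combination
        (-algebraMap k (Quot4 k a) (c 3) - algebraMap k (Quot4 k a) (c 7) * y a) * hx
    · refine ⟨![0, 0, a * c 4, a * c 5, c 0, c 1, c 2, c 3], ?_⟩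
      change _ = _ * y a
      rw [combination_apply, combination_apply]
      simp
      linear_combination (-algebraMap k (Quot4 k a) (c 4) - algebraMap k (Quot4 k a) (c 5) * x a
        - algebraMap k (Quot4 k a) (c 6) * x a ^ 2 - algebraMap k (Quot4 k a) (c 7) * x a ^ 3) * hy
        - (algebraMap k (Quot4 k a) (c 6) * algebraMap k (Quot4 k a) a
          + algebraMap k (Quot4 k a) (c 7) * algebraMap k (Quot4 k a) a * x a) * hx

/-- The evaluation `x ↦ r`, `y ↦ ω` in a quadratic extension `ω² = a r²` of an algebra
with an element `r` such that `r⁴ = 0`. -/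
noncomputable def toQuadratic (a : k) {R : Type*} [CommRing R] [Algebra k R] (r : R)
    (hr : r ^ 4 = 0) : Quot4 k a →+* QuadraticAlgebra R (algebraMap k R a * r ^ 2) 0 :=
  Ideal.Quotient.lift _ (MvPolynomial.eval₂Hom
    ((algebraMap R (QuadraticAlgebra R (algebraMap k R a * r ^ 2) 0)).comp (algebraMap k R))
    ![⟨r, 0⟩, ⟨0, 1⟩]) (by
      intro p hp
      rw [← RingHom.mem_ker]
      revert p
      change Ideal.span _ ≤ _
      rw [Ideal.span_le]
      rintro p (rfl | rfl)
      · simp only [SetLike.mem_coe, RingHom.mem_ker]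
        ext <;> simp [pow_succ] at hr ⊢
        exact hr
      · simp only [SetLike.mem_coe, RingHom.mem_ker]
        ext <;> simp [pow_two])

section toQuadratic

variable (a : k) {R : Type*} [CommRing R] [Algebra k R] (r : R) (hr : r ^ 4 = 0)

lemma toQuadratic_algebraMap (c : k) :
    toQuadratic a r hr (algebraMap k _ c) = ⟨algebraMap k R c, 0⟩ := by
  change MvPolynomial.eval₂Hom _ _ (C c) = _
  rw [MvPolynomial.eval₂Hom_C]
  rfl

lemma toQuadratic_x : toQuadratic a r hr (x a) = ⟨r, 0⟩ := by
  change MvPolynomial.eval₂Hom _ _ (X 0) = _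
  rw [MvPolynomial.eval₂Hom_X']
  rfl

lemma toQuadratic_y : toQuadratic a r hr (y a) = ⟨0, 1⟩ := by
  change MvPolynomial.eval₂Hom _ _ (X 1) = _
  rw [MvPolynomial.eval₂Hom_X']
  rfl

lemma toQuadratic_combination (c : Fin 8 → k) :
    toQuadratic a r hr (combination a c) =
      ⟨algebraMap k R (c 0) + algebraMap k R (c 1) * r + algebraMap k R (c 2) * r ^ 2
        + algebraMap k R (c 3) * r ^ 3,
      algebraMap k R (c 4) + algebraMap k R (c 5) * r + algebraMap k R (c 6) * r ^ 2
        + algebraMap k R (c 7) * r ^ 3⟩ := by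
  rw [combination_apply]
  simp only [map_add, map_mul, map_pow, toQuadratic_algebraMap, toQuadratic_x, toQuadratic_y]
  ext <;> simp [pow_succ]

end toQuadratic

lemma root_pow_four : AdjoinRoot.root (Polynomial.X ^ 4 : Polynomial k) ^ 4 = 0 := by
  have h := AdjoinRoot.eval₂_root (Polynomial.X ^ 4 : Polynomial k)
  simpa using h

lemma coeffs_eq_zero_of_root_combination_eq_zero {c₀ c₁ c₂ c₃ : k}
    (h : AdjoinRoot.of _ c₀ + AdjoinRoot.of _ c₁ * AdjoinRoot.root (Polynomial.X ^ 4)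
      + AdjoinRoot.of _ c₂ * AdjoinRoot.root _ ^ 2
      + AdjoinRoot.of _ c₃ * AdjoinRoot.root _ ^ 3 = 0) :
    c₀ = 0 ∧ c₁ = 0 ∧ c₂ = 0 ∧ c₃ = 0 := by
  have h' : AdjoinRoot.mk (Polynomial.X ^ 4) (Polynomial.C c₀ + Polynomial.C c₁ * Polynomial.X
      + Polynomial.C c₂ * Polynomial.X ^ 2 + Polynomial.C c₃ * Polynomial.X ^ 3) = 0 := by
    simpa using h
  rw [AdjoinRoot.mk_eq_zero, Polynomial.X_pow_dvd_iff] at h'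
  have h0 := h' 0 (by norm_num)
  have h1 := h' 1 (by norm_num)
  have h2 := h' 2 (by norm_num)
  have h3 := h' 3 (by norm_num)
  simp [Polynomial.coeff_X, Polynomial.coeff_X_pow, Polynomial.coeff_C] at h0 h1 h2 h3
  exact ⟨h0, h1, h2, h3⟩

lemma combination_injective (a : k) : Function.Injective (combination a) := by
  rw [injective_iff_map_eq_zero]
  intro c hc
  have h := congrArg (toQuadratic a _ (root_pow_four (k := k))) hc
  rw [toQuadratic_combination, map_zero] at h
  obtain ⟨h0, h1, h2, h3⟩ :=
    coeffs_eq_zero_of_root_combination_eq_zero (congrArg QuadraticAlgebra.re h)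
  obtain ⟨h4, h5, h6, h7⟩ :=
    coeffs_eq_zero_of_root_combination_eq_zero (congrArg QuadraticAlgebra.im h)
  ext i
  fin_cases i <;> assumption

/-- The coordinates on `Quot4 k a` with respect to the monomials. -/
noncomputable def coordinates (a : k) : Quot4 k a ≃ₗ[k] (Fin 8 → k) :=
  (LinearEquiv.ofBijective (combination a)
    ⟨combination_injective a, combination_surjective a⟩).symm

lemma finrank_quot4 (a : k) : Module.finrank k (Quot4 k a) = 8 := by
  simpa using (coordinates a).finrank_eq

lemma finite_quot4 (a : k) : Module.Finite k (Quot4 k a) :=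
  Module.finite_of_finrank_pos (by rw [finrank_quot4]; norm_num)

lemma nontrivial_quot4 (a : k) : Nontrivial (Quot4 k a) :=
  Module.nontrivial_of_finrank_pos (R := k) (by rw [finrank_quot4]; norm_num)

lemma combination_coordinates (a : k) (f : Quot4 k a) : combination a (coordinates a f) = f :=
  (coordinates a).symm_apply_apply f

lemma sq_combination [CharP k 2] (a : k) (c : Fin 8 → k) :
    combination a c ^ 2
      = combination a ![c 0 ^ 2, 0, c 1 ^ 2 + a * c 4 ^ 2, 0, 0, 0, 0, 0] := by
  have : CharP (Quot4 k a) 2 := by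
    have := nontrivial_quot4 a
    exact charP_of_injective_algebraMap (algebraMap k (Quot4 k a)).injective 2
  have hx := x_pow_four a
  have hy := y_sq a
  rw [combination_apply, combination_apply]
  simp only [CharTwo.add_sq]
  simp [mul_pow, hy]
  linear_combination (algebraMap k (Quot4 k a) (c 2) ^ 2
    + algebraMap k (Quot4 k a) a * algebraMap k (Quot4 k a) (c 5) ^ 2
    + x a ^ 2 * algebraMap k (Quot4 k a) (c 3) ^ 2
    + x a ^ 2 * algebraMap k (Quot4 k a) a * algebraMap k (Quot4 k a) (c 6) ^ 2
    + x a ^ 4 * algebraMap k (Quot4 k a) a * algebraMap k (Quot4 k a) (c 7) ^ 2) * hx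

lemma sq_eq_zero_iff [CharP k 2] (a : k) (f : Quot4 k a) :
    f ^ 2 = 0 ↔ coordinates a f 0 = 0 ∧
      coordinates a f 1 ^ 2 + a * coordinates a f 4 ^ 2 = 0 := by
  conv_lhs => rw [← combination_coordinates a f, sq_combination,
    map_eq_zero_iff _ (combination_injective a)]
  simp [funext_iff, Fin.forall_fin_succ]

lemma isLocalRing_quot4 [CharP k 2] (a : k) : IsLocalRing (Quot4 k a) := by
  have := nontrivial_quot4 a
  refine IsLocalRing.of_isUnit_or_isUnit_one_sub_self fun f => ?_
  have h4 : f ^ 4 = algebraMap k _ (coordinates a f 0 ^ 4) := by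
    rw [show f ^ 4 = (f ^ 2) ^ 2 by ring, ← combination_coordinates a f, sq_combination,
      sq_combination, combination_apply, combination_coordinates]
    simp [← pow_mul]
  by_cases h0 : coordinates a f 0 = 0
  · right
    exact IsNilpotent.isUnit_one_sub ⟨4, by simp [h4, h0]⟩
  · left
    rw [← isUnit_pow_iff (n := 4) (by norm_num), h4]
    exact (IsUnit.mk0 _ (pow_ne_zero 4 h0)).map _

/-- The subspace on which the coordinates listed by `J` vanish. -/
noncomputable def vanishing (a : k) {m : ℕ} (J : Fin m → Fin 8) : Submodule k (Quot4 k a) :=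
  LinearMap.ker (LinearMap.funLeft k k J ∘ₗ (coordinates a).toLinearMap)

lemma mem_vanishing (a : k) {m : ℕ} (J : Fin m → Fin 8) (f : Quot4 k a) :
    f ∈ vanishing a J ↔ ∀ i, coordinates a f (J i) = 0 := by
  simp [vanishing, funext_iff, LinearMap.funLeft_apply]

lemma finrank_vanishing (a : k) {m : ℕ} (J : Fin m → Fin 8) (hJ : Function.Injective J) :
    m + Module.finrank k (vanishing a J) = 8 := by
  have := finite_quot4 a
  have h := LinearMap.finrank_range_add_finrank_ker
    (LinearMap.funLeft k k J ∘ₗ (coordinates a).toLinearMap)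
  have hs : Function.Surjective (LinearMap.funLeft k k J ∘ₗ (coordinates a).toLinearMap) := by
    rw [LinearMap.coe_comp]
    exact (LinearMap.funLeft_surjective_of_injective k k J hJ).comp (coordinates a).surjective
  rw [LinearMap.range_eq_top.2 hs, finrank_top, finrank_quot4,
    Module.finrank_fin_fun] at h
  exact h

lemma exists_submodule_of_forall_sq_ne [CharP k 2] (a : k) (ha : ∀ b : k, b ^ 2 ≠ a) :
    ∃ S : Submodule k (Quot4 k a), (∀ f, f ∈ S ↔ f ^ 2 = 0) ∧ Module.finrank k S = 5 := by
  refine ⟨vanishing a ![0, 1, 4], fun f => ?_, ?_⟩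
  · rw [mem_vanishing, sq_eq_zero_iff]
    simp only [Fin.forall_fin_succ, IsEmpty.forall_iff, and_true]
    refine and_congr_right fun _ => ⟨?_, fun h => ?_⟩
    · rintro ⟨h1, h4⟩
      simp at h1 h4
      simp [h1, h4]
    · have h4 : coordinates a f 4 = 0 := by
        by_contra h4
        refine ha (coordinates a f 1 / coordinates a f 4) ?_
        rw [div_pow, div_eq_iff (pow_ne_zero 2 h4)]
        exact CharTwo.add_eq_zero.1 h
      simp [h4] at h
      exact ⟨h, h4⟩
  · have := finrank_vanishing a ![0, 1, 4] (by decide)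
    omega

lemma exists_submodule_zero [CharP k 2] :
    ∃ S : Submodule k (Quot4 k (0 : k)), (∀ f, f ∈ S ↔ f ^ 2 = 0) ∧ Module.finrank k S = 6 := by
  refine ⟨vanishing 0 ![0, 1], fun f => ?_, ?_⟩
  · rw [mem_vanishing, sq_eq_zero_iff]
    simp [Fin.forall_fin_succ]
  · have := finrank_vanishing (0 : k) ![0, 1] (by decide)
    omega

end SquareZero

lemma finrank_eq_of_algEquiv_of_mem_iff_sq_eq_zero {k A B : Type*} [Field k] [CommRing A]
    [CommRing B] [Algebra k A] [Algebra k B] (e : A ≃ₐ[k] B) {S : Submodule k A}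
    {T : Submodule k B} (hS : ∀ f, f ∈ S ↔ f ^ 2 = 0) (hT : ∀ f, f ∈ T ↔ f ^ 2 = 0) :
    Module.finrank k S = Module.finrank k T := by
  have h : S.map e.toLinearEquiv.toLinearMap = T := by
    ext f
    rw [Submodule.mem_map_equiv, hS, hT]
    change e.symm f ^ 2 = 0 ↔ _
    rw [← map_pow, map_eq_zero_iff _ e.symm.injective]
  rw [← h]
  exact (e.toLinearEquiv.finrank_map_eq S).symm

/-- Let `k` be a field of characteristic `2` and `a ∈ k ∖ k²`.  Let
`A = k[x,y]/(x⁴, y² − a x²)` and `B = k[s,t]/(s⁴, t²)`.  Then `A` and `B` are `8`-dimensional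
local `k`-algebras, the square-zero subspace `{f : f² = 0}` has dimension `5` in `A` and `6`
in `B`, and consequently `A` and `B` are not isomorphic as `k`-algebras.  (Hence the structure
theorem for connected finite group schemes over a perfect field fails over non-perfect
fields.) -/
theorem stmt7 (k : Type*) [Field k] [CharP k 2] (a : k) (ha : ∀ b : k, b ^ 2 ≠ a) :
    Module.finrank k (MvPolynomial (Fin 2) k ⧸
        Ideal.span {(X 0 : MvPolynomial (Fin 2) k) ^ 4, X 1 ^ 2 - C a * X 0 ^ 2}) = 8 ∧
    Module.finrank k (MvPolynomial (Fin 2) k ⧸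
        Ideal.span {(X 0 : MvPolynomial (Fin 2) k) ^ 4, X 1 ^ 2}) = 8 ∧
    IsLocalRing (MvPolynomial (Fin 2) k ⧸
        Ideal.span {(X 0 : MvPolynomial (Fin 2) k) ^ 4, X 1 ^ 2 - C a * X 0 ^ 2}) ∧
    IsLocalRing (MvPolynomial (Fin 2) k ⧸
        Ideal.span {(X 0 : MvPolynomial (Fin 2) k) ^ 4, X 1 ^ 2}) ∧
    (∃ S : Submodule k (MvPolynomial (Fin 2) k ⧸
        Ideal.span {(X 0 : MvPolynomial (Fin 2) k) ^ 4, X 1 ^ 2 - C a * X 0 ^ 2}),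
      (∀ f, f ∈ S ↔ f ^ 2 = 0) ∧ Module.finrank k S = 5) ∧
    (∃ S : Submodule k (MvPolynomial (Fin 2) k ⧸
        Ideal.span {(X 0 : MvPolynomial (Fin 2) k) ^ 4, X 1 ^ 2}),
      (∀ f, f ∈ S ↔ f ^ 2 = 0) ∧ Module.finrank k S = 6) ∧
    IsEmpty ((MvPolynomial (Fin 2) k ⧸
        Ideal.span {(X 0 : MvPolynomial (Fin 2) k) ^ 4, X 1 ^ 2 - C a * X 0 ^ 2}) ≃ₐ[k]
      (MvPolynomial (Fin 2) k ⧸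
        Ideal.span {(X 0 : MvPolynomial (Fin 2) k) ^ 4, X 1 ^ 2})) := by
  have hB : Ideal.span {(X 0 : MvPolynomial (Fin 2) k) ^ 4, X 1 ^ 2}
      = Ideal.span {(X 0 : MvPolynomial (Fin 2) k) ^ 4, X 1 ^ 2 - C 0 * X 0 ^ 2} := by
    simp
  rw [hB]
  refine ⟨SquareZero.finrank_quot4 a, SquareZero.finrank_quot4 0,
    SquareZero.isLocalRing_quot4 a, SquareZero.isLocalRing_quot4 0,
    SquareZero.exists_submodule_of_forall_sq_ne a ha, SquareZero.exists_submodule_zero,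
    ⟨fun e => ?_⟩⟩
  obtain ⟨S, hS, hS5⟩ := SquareZero.exists_submodule_of_forall_sq_ne a ha
  obtain ⟨T, hT, hT6⟩ := SquareZero.exists_submodule_zero (k := k)
  have h := finrank_eq_of_algEquiv_of_mem_iff_sq_eq_zero e hS hT
  exact absurd (hS5.symm.trans (h.trans hT6)) (by norm_num)
end

section
/- Let k be an algebraically closed field of characteristic p > 0 and let n ≥ 1 (so that np ≥ 2). Let f = y^{np} + y·z^{np−1} − x^{np−1}·z ∈ k[x,y,z]. Then the projective plane curve defined by f = 0 is smooth: for every (x₀, y₀, z₀) ∈ k³ with (x₀, y₀, z₀) ≠ (0,0,0) and f(x₀, y₀, z₀) = 0, at least one of the partial derivatives ∂f/∂x, ∂f/∂y, ∂f/∂z does not vanish at (x₀, y₀, z₀). -/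
open MvPolynomial

/-- **The Tango curve is smooth.**  Let `k` be an algebraically closed field of
characteristic `p > 0` and `n ≥ 1` (so `np ≥ 2`).  The projective plane curve
`y^{np} + y z^{np−1} − x^{np−1} z = 0` is smooth: at every nonzero point of `k³` lying on
the curve, at least one of the three partial derivatives of the defining polynomial does
not vanish (Jacobian criterion). -/
theorem stmt16 (p : ℕ) [Fact p.Prime] (k : Type*) [Field k] [IsAlgClosed k] [CharP k p]
    (n : ℕ) (hn : 1 ≤ n) :
    let f : MvPolynomial (Fin 3) k :=
      X 1 ^ (n * p) + X 1 * X 2 ^ (n * p - 1) - X 0 ^ (n * p - 1) * X 2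
    ∀ P : Fin 3 → k, P ≠ 0 → eval P f = 0 →
      eval P (pderiv 0 f) ≠ 0 ∨ eval P (pderiv 1 f) ≠ 0 ∨ eval P (pderiv 2 f) ≠ 0 := by
  intro f P hP hf
  have hm : n * p - 1 ≠ 0 := by
    have := Nat.mul_le_mul hn (Fact.out : p.Prime).two_le
    omega
  by_contra! h
  obtain ⟨-, hy, hz⟩ := h
  have z0 : P 2 = 0 := by
    have : P 2 ^ (n * p - 1) = 0 := by
      simpa [f, pderiv_X, Pi.single_apply, Derivation.leibniz, Derivation.leibniz_pow] using hy
    exact eq_zero_of_pow_eq_zero this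
  have y0 : P 1 = 0 := by
    have : P 1 ^ (n * p) = 0 := by simpa [f, z0, hm] using hf
    exact eq_zero_of_pow_eq_zero this
  have x0 : P 0 = 0 := by
    have : P 0 ^ (n * p - 1) = 0 := by
      simpa [f, pderiv_X, Pi.single_apply, Derivation.leibniz, Derivation.leibniz_pow, y0] using hz
    exact eq_zero_of_pow_eq_zero this
  exact hP (by ext i; fin_cases i <;> assumption)
end
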